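/- arXiv:1412.1526 — 2 statements merged into one kernel-verified Lean document; each statement's English description precedes it below -/
import Mathlib

section
/- Let G be a finite tree with vertex set V, let r ∈ V, and let N(r) be the set of neighbors of r in G. Then the map sending a family (S_k)_{k ∈ N(r)} — where for each neighbor k, S_k is either the empty set or a connected subset of the branch B(r,k) containing k — to the set {r} ∪ ⋃_{k ∈ N(r)} S_k, is a bijection from the set of all such families onto the set of connected subsets of V that contain r. -/
open scoped Classical

/-- A subset of vertices is connected if the subgraph induced on it is connected. -/
def IsConnSubset {V : Type*} (G : SimpleGraph V) (S : Set V) : Prop :=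
  (G.induce S).Connected

/-- The branch `B(r,k)` of a neighbor `k` at `r`: the vertex set of the connected
component containing `k` of the graph obtained from `G` by deleting the vertex `r`. -/
def branch {V : Type*} (G : SimpleGraph V) (r k : V) : Set V :=
  {v : V | ∃ (hk : k ≠ r) (hv : v ≠ r),
    (G.induce {x : V | x ≠ r}).Reachable ⟨k, hk⟩ ⟨v, hv⟩}

namespace SimpleGraph

variable {V : Type*} {G : SimpleGraph V}

lemma reachable_induce_iff_exists_walk {s : Set V} {u v : V} (hu : u ∈ s) (hv : v ∈ s) :
    (G.induce s).Reachable ⟨u, hu⟩ ⟨v, hv⟩ ↔ ∃ p : G.Walk u v, ∀ x ∈ p.support, x ∈ s := by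
  constructor
  · rintro ⟨q⟩
    have hq : ∀ x ∈ (q.map (Embedding.induce s).toHom).support, x ∈ s := by
      intro x hx
      rw [Walk.support_map, List.mem_map] at hx
      obtain ⟨y, -, rfl⟩ := hx
      exact y.2
    exact ⟨_, hq⟩
  · rintro ⟨p, hp⟩
    exact ⟨p.induce s hp⟩

lemma mem_branch_iff_exists_walk {r k v : V} :
    v ∈ branch G r k ↔ ∃ p : G.Walk k v, ∀ x ∈ p.support, x ≠ r := by
  constructor
  · rintro ⟨hk, hv, h⟩
    exact (reachable_induce_iff_exists_walk (s := {x | x ≠ r}) hk hv).1 h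
  · rintro ⟨p, hp⟩
    exact ⟨hp _ p.start_mem_support, hp _ p.end_mem_support,
      (reachable_induce_iff_exists_walk (s := {x | x ≠ r}) _ _).2 ⟨p, hp⟩⟩

lemma Walk.support_subset_branch {r k v : V} (p : G.Walk k v) (hp : ∀ x ∈ p.support, x ≠ r)
    {x : V} (hx : x ∈ p.support) : x ∈ branch G r k :=
  mem_branch_iff_exists_walk.2
    ⟨p.takeUntil x hx, fun y hy => hp y (p.support_takeUntil_subset_support hx hy)⟩

lemma IsAcyclic.eq_of_mem_branch (hG : G.IsAcyclic) {r k l v : V} (hk : G.Adj r k)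
    (hl : G.Adj r l) (hvk : v ∈ branch G r k) (hvl : v ∈ branch G r l) : k = l := by
  by_contra hne
  obtain ⟨p, hp⟩ := mem_branch_iff_exists_walk.1 hvk
  obtain ⟨q, hq⟩ := mem_branch_iff_exists_walk.1 hvl
  let w : G.Walk k l := p.append q.reverse
  have hw : ∀ x ∈ w.bypass.support, x ≠ r := by
    intro x hx
    have hx' := w.support_bypass_subset_support hx
    rw [Walk.mem_support_append_iff, Walk.support_reverse, List.mem_reverse] at hx'
    exact hx'.elim (hp x) (hq x)
  let u : G.Walk k l := .cons hk.symm (.cons hl .nil)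
  have hu : u.IsPath := by
    simp [u, Walk.cons_isPath_iff, hk.ne', hl.ne, hne]
  have h : w.bypass = u := congrArg Subtype.val
    ((hG.subsingleton_path k l).elim ⟨w.bypass, w.bypass_isPath⟩ ⟨u, hu⟩)
  exact hw r (by simp [h, u]) rfl

end SimpleGraph

namespace IsConnSubset

open SimpleGraph

variable {V : Type*} {G : SimpleGraph V} {S : Set V} {r : V}

lemma exists_adj_walk (hS : IsConnSubset G S) (hr : r ∈ S) {v : V} (hv : v ∈ S) (hvr : v ≠ r) :
    ∃ k, G.Adj r k ∧ ∃ p : G.Walk k v, ∀ x ∈ p.support, x ∈ S ∧ x ≠ r := by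
  obtain ⟨p, hp⟩ := (reachable_induce_iff_exists_walk hr hv).1 (hS.preconnected ⟨r, hr⟩ ⟨v, hv⟩)
  have hpath := p.bypass_isPath
  have hsupp : ∀ x ∈ p.bypass.support, x ∈ S := fun x hx => hp x (p.support_bypass_subset_support hx)
  generalize p.bypass = q at hpath hsupp
  cases q with
  | nil => exact absurd rfl hvr
  | cons h q =>
    rw [Walk.cons_isPath_iff] at hpath
    refine ⟨_, h, q, fun x hx => ⟨hsupp x (by simp [hx]), ?_⟩⟩
    rintro rfl
    exact hpath.2 hx

lemma mem_branch_inter_walk (hS : IsConnSubset G S) (hG : G.IsAcyclic) (hr : r ∈ S) {k v : V}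
    (hk : G.Adj r k) (hv : v ∈ S ∩ branch G r k) :
    ∃ p : G.Walk k v, ∀ x ∈ p.support, x ∈ S ∩ branch G r k := by
  obtain ⟨-, hvr, -⟩ := id hv.2
  obtain ⟨l, hl, p, hp⟩ := hS.exists_adj_walk hr hv.1 hvr
  have hbranch : ∀ x ∈ p.support, x ∈ branch G r l := fun x hx =>
    p.support_subset_branch (fun y hy => (hp y hy).2) hx
  obtain rfl := hG.eq_of_mem_branch hk hl hv.2 (hbranch v p.end_mem_support)
  exact ⟨p, fun x hx => ⟨(hp x hx).1, hbranch x hx⟩⟩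

lemma inter_branch (hS : IsConnSubset G S) (hG : G.IsAcyclic) (hr : r ∈ S) {k : V}
    (hk : G.Adj r k) (hne : (S ∩ branch G r k).Nonempty) :
    k ∈ S ∩ branch G r k ∧ IsConnSubset G (S ∩ branch G r k) := by
  obtain ⟨v, hv⟩ := hne
  obtain ⟨p, hp⟩ := hS.mem_branch_inter_walk hG hr hk hv
  have hkS := hp k p.start_mem_support
  refine ⟨hkS, induce_connected_of_patches k hkS fun {w} hw => ?_⟩
  exact ⟨_, subset_rfl, hkS, hw,
    (reachable_induce_iff_exists_walk hkS hw).2 (hS.mem_branch_inter_walk hG hr hk hw)⟩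

lemma insert_iUnion {ι : Type*} {f : ι → Set V} {k : ι → V} (hk : ∀ i, G.Adj r (k i))
    (hf : ∀ i, f i = ∅ ∨ (k i ∈ f i ∧ IsConnSubset G (f i))) :
    IsConnSubset G ({r} ∪ ⋃ i, f i) := by
  refine induce_connected_of_patches r (Or.inl rfl) fun {v} hv => ?_
  rcases hv with rfl | hv
  · exact ⟨{v}, Set.subset_union_left, rfl, rfl, .rfl⟩
  · obtain ⟨i, hi⟩ := Set.mem_iUnion.1 hv
    rcases hf i with h | ⟨hki, hc⟩
    · simp [h] at hi
    · exact ⟨{r} ∪ f i, Set.union_subset_union_right _ (Set.subset_iUnion f i), Or.inl rfl,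
        Or.inr hi, (connected_induce_union (Preconnected.of_subsingleton) hc.preconnected
          (Set.mem_singleton r) hki (hk i)).preconnected _ _⟩

end IsConnSubset

lemma SimpleGraph.IsAcyclic.union_iUnion_inter_branch {V : Type*} {G : SimpleGraph V}
    (hG : G.IsAcyclic) {r : V} {f : {k // G.Adj r k} → Set V}
    (hf : ∀ k, f k ⊆ branch G r k) (k : {k // G.Adj r k}) :
    ({r} ∪ ⋃ l, f l) ∩ branch G r k = f k := by
  ext v
  constructor
  · rintro ⟨rfl | hv, hvk⟩
    · exact absurd rfl hvk.2.1
    · obtain ⟨l, hl⟩ := Set.mem_iUnion.1 hv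
      obtain rfl := Subtype.ext (hG.eq_of_mem_branch k.2 l.2 hvk (hf l hl))
      exact hl
  · exact fun hv => ⟨Or.inr (Set.mem_iUnion.2 ⟨k, hv⟩), hf k hv⟩

/-- For a finite tree `G` and a vertex `r`, the map sending a family
`(S_k)` indexed by the neighbors `k` of `r` — where each `S_k` is either empty or a
connected subset of the branch `B(r,k)` containing `k` — to `{r} ∪ ⋃ k, S_k`, is a
bijection onto the set of connected subsets of the vertices containing `r`. -/
theorem stmt0 {V : Type*} [Fintype V] (G : SimpleGraph V) (hG : G.IsTree) (r : V) :
    Set.BijOn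
      (fun f : {k // G.Adj r k} → Set V => {r} ∪ ⋃ k : {k // G.Adj r k}, f k)
      {f : {k // G.Adj r k} → Set V | ∀ k : {k // G.Adj r k},
        f k = ∅ ∨ (f k ⊆ branch G r (k : V) ∧ (k : V) ∈ f k ∧ IsConnSubset G (f k))}
      {S : Set V | r ∈ S ∧ IsConnSubset G S} := by
  refine ⟨fun f hf => ⟨Or.inl rfl, IsConnSubset.insert_iUnion (fun k => k.2) fun k =>
    (hf k).imp_right And.right⟩, fun f hf g hg hfg => ?_, fun S ⟨hr, hS⟩ => ?_⟩
  · have hsub : ∀ f : {k // G.Adj r k} → Set V, (∀ k : {k // G.Adj r k}, f k = ∅ ∨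
        (f k ⊆ branch G r (k : V) ∧ (k : V) ∈ f k ∧ IsConnSubset G (f k))) →
        ∀ k, f k ⊆ branch G r k := fun f hf k =>
      (hf k).elim (fun h => h ▸ Set.empty_subset _) And.left
    funext k
    rw [← hG.isAcyclic.union_iUnion_inter_branch (hsub f hf) k,
      ← hG.isAcyclic.union_iUnion_inter_branch (hsub g hg) k]
    exact congrArg (· ∩ branch G r k) hfg
  · refine ⟨fun k => S ∩ branch G r k, fun k => ?_, ?_⟩
    · exact (Set.eq_empty_or_nonempty _).imp_right fun hne =>
        ⟨Set.inter_subset_right, hS.inter_branch hG.isAcyclic hr k.2 hne⟩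
    · refine subset_antisymm (Set.union_subset (Set.singleton_subset_iff.2 hr)
        (Set.iUnion_subset fun k => Set.inter_subset_left)) fun v hv => ?_
      by_cases hvr : v = r
      · exact Or.inl hvr
      · obtain ⟨k, hk, p, hp⟩ := hS.exists_adj_walk hr hv hvr
        exact Or.inr (Set.mem_iUnion.2 ⟨⟨k, hk⟩, hv,
          p.support_subset_branch (fun x hx => (hp x hx).2) p.end_mem_support⟩)
end

section
/- Let G be a finite tree with vertex set V, r ∈ V with neighbor set N(r), and for each k ∈ N(r) let S_k be either the empty set or a connected subset of the branch B(r,k) containing k, and set S = {r} ∪ ⋃_{k ∈ N(r)} S_k. Then the score satisfies F(S) = a(r) + ∑_{k ∈ N(r)} c_k, where c_k = D(r,k) if S_k = ∅, and c_k = R({r,k}) + F_{B(r,k)}(S_k) if S_k ≠ ∅. -/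
open scoped Classical

/-- The score `F_W(S)` of a subset `S` computed within the subgraph of `G` induced on `W`:
the sum of the vertex scores `a` over `S`, plus the sum of the edge scores `R` over edges
of `G` with both endpoints in `S`, plus the sum of the decoupling scores `D` over ordered
pairs `(i,j)` of adjacent vertices of `G` lying in `W` with `i ∈ S` and `j ∉ S`.
Taking `W = Set.univ` gives the full score `F(S)`. -/
noncomputable def score {V : Type*} (G : SimpleGraph V) (a : V → ℝ) (R : Sym2 V → ℝ)
    (D : V → V → ℝ) (W S : Set V) : ℝ :=
  (∑ᶠ v ∈ S, a v)
    + (∑ᶠ e ∈ {e : Sym2 V | e ∈ G.edgeSet ∧ ∀ v ∈ e, v ∈ S}, R e)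
    + (∑ᶠ p ∈ {p : V × V | G.Adj p.1 p.2 ∧ p.1 ∈ W ∧ p.2 ∈ W ∧ p.1 ∈ S ∧ p.2 ∉ S},
        D p.1 p.2)

theorem self_mem_branch {V : Type*} {G : SimpleGraph V} {r k : V} (h : G.Adj r k) :
    k ∈ branch G r k :=
  ⟨h.ne', h.ne', SimpleGraph.Reachable.refl _⟩

theorem notMem_branch {V : Type*} {G : SimpleGraph V} {r k : V} : r ∉ branch G r k :=
  fun ⟨_, hr, _⟩ => hr rfl

theorem mem_branch_of_adj {V : Type*} {G : SimpleGraph V} {r k v w : V}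
    (hv : v ∈ branch G r k) (h : G.Adj v w) (hw : w ≠ r) : w ∈ branch G r k := by
  obtain ⟨hk, hvr, hreach⟩ := hv
  refine ⟨hk, hw, hreach.trans (SimpleGraph.Adj.reachable ?_)⟩
  simpa using h

/-- In an acyclic graph, the branches at `r` of distinct neighbors of `r` are disjoint. -/
theorem eq_of_mem_branch {V : Type*} {G : SimpleGraph V} (hG : G.IsAcyclic) {r k l v : V}
    (hk : G.Adj r k) (hl : G.Adj r l) (hvk : v ∈ branch G r k) (hvl : v ∈ branch G r l) :
    k = l := by
  by_contra hne
  obtain ⟨hkr, hv, h₁⟩ := hvk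
  obtain ⟨hlr, _, h₂⟩ := hvl
  have hbridge := SimpleGraph.isAcyclic_iff_forall_adj_isBridge.1 hG hk
  rw [SimpleGraph.isBridge_iff] at hbridge
  apply hbridge
  let φ : G.induce {x : V | x ≠ r} →g G.deleteEdges {s(r, k)} :=
    { toFun := Subtype.val
      map_rel' := by
        rintro ⟨x, hx⟩ ⟨y, hy⟩ hxy
        have hx' : x ≠ r := hx
        have hy' : y ≠ r := hy
        have hxy' : G.Adj x y := hxy
        simp [SimpleGraph.deleteEdges_adj, hxy', hx', hy'] }
  have hlk : (G.deleteEdges {s(r, k)}).Reachable l k := (h₂.trans h₁.symm).map φ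
  refine SimpleGraph.Reachable.trans (SimpleGraph.Adj.reachable ?_) hlk
  simp [SimpleGraph.deleteEdges_adj, hl, hlr, Ne.symm hne]

/-- Let `G` be a finite tree, `r` a vertex, and for each neighbor `k` of `r`
let `S_k = f k` be either empty or a connected subset of the branch `B(r,k)` containing
`k`; set `S = {r} ∪ ⋃ k, S_k`. Then
`F(S) = a(r) + ∑_{k ∈ N(r)} c_k`, where `c_k = D(r,k)` if `S_k = ∅`, and
`c_k = R({r,k}) + F_{B(r,k)}(S_k)` otherwise. -/
theorem stmt1 {V : Type*} [Fintype V] (G : SimpleGraph V) (hG : G.IsTree)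
    (a : V → ℝ) (R : Sym2 V → ℝ) (D : V → V → ℝ) (r : V)
    (f : {k // G.Adj r k} → Set V)
    (hf : ∀ k : {k // G.Adj r k},
      f k = ∅ ∨ (f k ⊆ branch G r (k : V) ∧ (k : V) ∈ f k ∧ IsConnSubset G (f k)))
    (S : Set V) (hS : S = {r} ∪ ⋃ k : {k // G.Adj r k}, f k) :
    score G a R D Set.univ S =
      a r + ∑ k : {k // G.Adj r k},
        (if f k = ∅ then D r (k : V)
         else R s(r, (k : V)) + score G a R D (branch G r (k : V)) (f k)) := by
  have hsub : ∀ k v, v ∈ f k → v ∈ branch G r (k : V) := by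
    intro k v hv
    rcases hf k with h | h
    · simp [h] at hv
    · exact h.1 hv
  have hr : ∀ k, r ∉ f k := fun k h => notMem_branch (hsub k r h)
  have huniq : ∀ (k l : {k // G.Adj r k}) v,
      v ∈ branch G r (k : V) → v ∈ branch G r (l : V) → k = l :=
    fun k l v h₁ h₂ => Subtype.ext (eq_of_mem_branch hG.isAcyclic k.2 l.2 h₁ h₂)
  have hroot : ∀ (k l : {k // G.Adj r k}), (k : V) ∈ f l → k = l :=
    fun k l h => huniq k l k (self_mem_branch k.2) (hsub l _ h)
  have hmemS : ∀ v, v ∈ S ↔ v = r ∨ ∃ k, v ∈ f k := by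
    intro v; simp [hS]
  have hkmem : ∀ k, f k ≠ ∅ → (k : V) ∈ f k := fun k h => ((hf k).resolve_left h).2.1
  have hkS : ∀ k : {k // G.Adj r k}, (k : V) ∈ S ↔ f k ≠ ∅ := by
    intro k
    rw [hmemS]
    constructor
    · rintro (h | ⟨l, hl⟩)
      · exact absurd h k.2.ne'
      · obtain rfl := hroot k l hl
        exact Set.nonempty_iff_ne_empty.1 ⟨_, hl⟩
    · exact fun h => Or.inr ⟨k, hkmem k h⟩
  let E : {k // G.Adj r k} → Set (Sym2 V) := fun k => {e | e ∈ G.edgeSet ∧ ∀ v ∈ e, v ∈ f k}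
  let P : {k // G.Adj r k} → Set (V × V) := fun k =>
    {p | G.Adj p.1 p.2 ∧ p.1 ∈ branch G r (k : V) ∧ p.2 ∈ branch G r (k : V) ∧
      p.1 ∈ f k ∧ p.2 ∉ f k}
  let E' : {k // G.Adj r k} → Set (Sym2 V) := fun k => if f k = ∅ then ∅ else insert s(r, k) (E k)
  let P' : {k // G.Adj r k} → Set (V × V) := fun k => if f k = ∅ then {(r, (k : V))} else P k
  have hvert : ∑ᶠ v ∈ S, a v = a r + ∑ k, ∑ᶠ v ∈ f k, a v := by
    rw [hS, Set.singleton_union, finsum_mem_insert _ (by simpa using hr) (Set.toFinite _),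
      finsum_mem_iUnion _ (fun _ => Set.toFinite _), finsum_eq_sum_of_fintype]
    intro k l hkl
    exact Set.disjoint_left.2 fun v hk hl => hkl (huniq k l v (hsub k v hk) (hsub l v hl))
  have hedge : {e : Sym2 V | e ∈ G.edgeSet ∧ ∀ v ∈ e, v ∈ S} = ⋃ k, E' k := by
    have hE' : ∀ k e, e ∈ E' k ↔ f k ≠ ∅ ∧ (e = s(r, (k : V)) ∨ e ∈ E k) := by
      intro k e
      by_cases h : f k = ∅ <;> simp [E', h]
    ext e
    simp only [Set.mem_iUnion, hE', Set.mem_ofPred_eq]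
    constructor
    · induction e using Sym2.ind with
      | _ x y =>
      rintro ⟨hxy, h⟩
      rw [SimpleGraph.mem_edgeSet] at hxy
      have hx := h x (by simp)
      have hy := h y (by simp)
      by_cases hxr : x = r
      · subst hxr
        exact ⟨⟨y, hxy⟩, (hkS ⟨y, hxy⟩).1 hy, Or.inl rfl⟩
      by_cases hyr : y = r
      · subst hyr
        exact ⟨⟨x, hxy.symm⟩, (hkS ⟨x, hxy.symm⟩).1 hx, Or.inl Sym2.eq_swap⟩
      obtain ⟨k, hk⟩ := ((hmemS x).1 hx).resolve_left hxr
      obtain ⟨l, hl⟩ := ((hmemS y).1 hy).resolve_left hyr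
      obtain rfl := huniq k l y (mem_branch_of_adj (hsub k x hk) hxy hyr) (hsub l y hl)
      refine ⟨k, Set.nonempty_iff_ne_empty.1 ⟨_, hk⟩, Or.inr ⟨hxy, ?_⟩⟩
      simp [hk, hl]
    · rintro ⟨k, hk, rfl | ⟨he, h⟩⟩
      · refine ⟨k.2, ?_⟩
        simp only [Sym2.mem_iff, forall_eq_or_imp, forall_eq]
        exact ⟨(hmemS r).2 (Or.inl rfl), (hkS k).2 hk⟩
      · exact ⟨he, fun v hv => (hmemS v).2 (Or.inr ⟨k, h v hv⟩)⟩
  have hEsub : ∀ k e, e ∈ E' k → ∀ v ∈ e, v ≠ r → v ∈ branch G r (k : V) := by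
    intro k e he v hv hvr
    by_cases h : f k = ∅
    · simp [E', h] at he
    · simp only [E', h, if_false] at he
      rcases he with rfl | he
      · rcases Sym2.mem_iff.1 hv with rfl | rfl
        · exact absurd rfl hvr
        · exact self_mem_branch k.2
      · exact hsub k v (he.2 v hv)
  have hEdisj : Pairwise (Function.onFun Disjoint E') := by
    intro k l hkl
    refine Set.disjoint_left.2 fun e hk hl => hkl ?_
    have he : e ∈ G.edgeSet := by
      have : e ∈ ⋃ k, E' k := Set.mem_iUnion.2 ⟨k, hk⟩
      rw [← hedge] at this
      exact this.1
    have hv : ∃ v ∈ e, v ≠ r := by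
      induction e using Sym2.ind with
      | _ x y =>
      by_cases hx : x = r
      · exact ⟨y, by simp, fun hy => (SimpleGraph.mem_edgeSet G |>.1 he).ne (hx.trans hy.symm)⟩
      · exact ⟨x, by simp, hx⟩
    obtain ⟨v, hv, hvr⟩ := hv
    exact huniq k l v (hEsub k e hk v hv hvr) (hEsub l e hl v hv hvr)
  have hpair : {p : V × V | G.Adj p.1 p.2 ∧ p.1 ∈ Set.univ ∧ p.2 ∈ Set.univ ∧
      p.1 ∈ S ∧ p.2 ∉ S} = ⋃ k, P' k := by
    have hP' : ∀ k p, p ∈ P' k ↔ (f k = ∅ ∧ p = (r, (k : V))) ∨ p ∈ P k := by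
      intro k p
      by_cases h : f k = ∅ <;> simp [P', P, h]
    ext ⟨x, y⟩
    simp only [Set.mem_iUnion, hP', Set.mem_ofPred_eq, Set.mem_univ, true_and]
    constructor
    · rintro ⟨hxy, hx, hy⟩
      have hyr : y ≠ r := fun h => hy ((hmemS y).2 (Or.inl h))
      rcases (hmemS x).1 hx with rfl | ⟨k, hk⟩
      · exact ⟨⟨y, hxy⟩, Or.inl ⟨by_contra fun h => hy ((hkS ⟨y, hxy⟩).2 h), rfl⟩⟩
      · exact ⟨k, Or.inr ⟨hxy, hsub k x hk, mem_branch_of_adj (hsub k x hk) hxy hyr, hk,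
          fun h => hy ((hmemS y).2 (Or.inr ⟨k, h⟩))⟩⟩
    · rintro ⟨k, ⟨hk, h⟩ | ⟨hxy, -, hyk, hx, hy⟩⟩
      · obtain ⟨rfl, rfl⟩ := Prod.mk.inj h
        exact ⟨k.2, (hmemS _).2 (Or.inl rfl), fun h => (hkS k).1 h hk⟩
      · refine ⟨hxy, (hmemS x).2 (Or.inr ⟨k, hx⟩), fun h => ?_⟩
        rcases (hmemS y).1 h with rfl | ⟨l, hl⟩
        · exact notMem_branch hyk
        · obtain rfl := huniq k l y hyk (hsub l y hl)
          exact hy hl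
  have hPsub : ∀ k p, p ∈ P' k → p.2 ∈ branch G r (k : V) := by
    intro k p hp
    by_cases h : f k = ∅
    · simp only [P', h, if_true, Set.mem_singleton_iff] at hp
      subst hp
      exact self_mem_branch k.2
    · simp only [P', h, if_false] at hp
      exact hp.2.2.1
  have hPdisj : Pairwise (Function.onFun Disjoint P') := fun k l hkl =>
    Set.disjoint_left.2 fun p hk hl => hkl (huniq k l p.2 (hPsub k p hk) (hPsub l p hl))
  unfold score
  rw [hvert, hedge, hpair, finsum_mem_iUnion hEdisj (fun _ => Set.toFinite _),
    finsum_mem_iUnion hPdisj (fun _ => Set.toFinite _), finsum_eq_sum_of_fintype,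
    finsum_eq_sum_of_fintype, add_assoc, add_assoc, ← Finset.sum_add_distrib,
    ← Finset.sum_add_distrib]
  congr 1
  refine Finset.sum_congr rfl fun k _ => ?_
  by_cases h : f k = ∅
  · simp [E', P', h]
  · have hnot : s(r, (k : V)) ∉ E k := fun he => hr k (he.2 r (by simp))
    simp only [E', P', h, if_false]
    rw [finsum_mem_insert _ hnot (Set.toFinite _)]
    simp only [E, P]
    ring
end
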